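/- Let X be a set, let G(z_1), …, G(z_N) and x_1, …, x_M be points of X (not necessarily distinct), and define the empirical weight functions δ_G(x) = #{i ≤ N : G(z_i) = x}/N and δ_r(x) = #{j ≤ M : x_j = x}/M. Then the supremum over all functions D : X → (0,1) of (1/M) Σ_{j=1}^M log D(x_j) + (1/N) Σ_{i=1}^N log(1 − D(G(z_i))) equals Σ_{x ∈ S} [ δ_r(x) log(δ_r(x)/(δ_r(x)+δ_G(x))) + δ_G(x) log(δ_G(x)/(δ_r(x)+δ_G(x))) ], where S = {G(z_1), …, G(z_N), x_1, …, x_M} and the convention 0·log(0/t) = 0 is used; moreover the bound is approached by discriminators with D(x) = δ_r(x)/(δ_r(x)+δ_G(x)) at every x ∈ S with 0 < δ_r(x)/(δ_r(x)+δ_G(x)) < 1. -/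

import Mathlib

open scoped BigOperators

/-- Gibbs' inequality for a single weight, with the linear defect made explicit. -/
lemma mul_log_le_mul_log_div_add {a s t : ℝ} (ha : 0 ≤ a) (hs : 0 < s) (ht : 0 < t) :
    a * Real.log t ≤ a * Real.log (a / s) + (t * s - a) := by
  rcases ha.eq_or_lt with rfl | ha
  · have := mul_pos ht hs
    simp only [zero_mul]
    linarith
  · have h := Real.log_le_sub_one_of_pos (div_pos ht (div_pos ha hs))
    rw [Real.log_div ht.ne' (div_pos ha hs).ne'] at h
    have h' := mul_le_mul_of_nonneg_left h ha.le
    have e : a * (t / (a / s) - 1) = t * s - a := by field_simp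
    linarith

lemma mul_log_add_mul_log_one_sub_le {a b t : ℝ} (ha : 0 ≤ a) (hb : 0 ≤ b) (hab : 0 < a + b)
    (ht : t ∈ Set.Ioo (0 : ℝ) 1) :
    a * Real.log t + b * Real.log (1 - t) ≤
      a * Real.log (a / (a + b)) + b * Real.log (b / (a + b)) := by
  have h₁ := mul_log_le_mul_log_div_add ha hab ht.1
  have h₂ := mul_log_le_mul_log_div_add hb hab (sub_pos.2 ht.2)
  linarith

lemma exists_mem_Ioo_mul_log_gt {b ε : ℝ} (hb : 0 ≤ b) (hε : 0 < ε) :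
    ∃ t ∈ Set.Ioo (0 : ℝ) 1, -ε < b * Real.log t := by
  have hη : 0 < ε / (b + 1) := by positivity
  refine ⟨Real.exp (-(ε / (b + 1))), ⟨Real.exp_pos _, by simpa using hη⟩, ?_⟩
  have e : ε / (b + 1) * (b + 1) = ε := by field_simp
  rw [Real.log_exp]
  linarith

lemma exists_mem_Ioo_mul_log_add_mul_log_gt {a b ε : ℝ} (ha : 0 ≤ a) (hb : 0 ≤ b)
    (hab : 0 < a + b) (hε : 0 < ε) :
    ∃ t ∈ Set.Ioo (0 : ℝ) 1, (a / (a + b) ∈ Set.Ioo (0 : ℝ) 1 → t = a / (a + b)) ∧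
      a * Real.log (a / (a + b)) + b * Real.log (b / (a + b)) - ε <
        a * Real.log t + b * Real.log (1 - t) := by
  rcases ha.eq_or_lt with rfl | ha
  · obtain ⟨t, ht, h⟩ := exists_mem_Ioo_mul_log_gt hb hε
    have hb' : b ≠ 0 := by linarith
    exact ⟨1 - t, ⟨by linarith [ht.2], by linarith [ht.1]⟩, by simp, by simpa [hb'] using h⟩
  rcases hb.eq_or_lt with rfl | hb
  · obtain ⟨t, ht, h⟩ := exists_mem_Ioo_mul_log_gt ha.le hε
    exact ⟨t, ht, by simp [ha.ne'], by simpa [ha.ne'] using h⟩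
  · refine ⟨a / (a + b), ⟨by positivity, (div_lt_one hab).2 (by linarith)⟩, fun _ => rfl, ?_⟩
    have e : 1 - a / (a + b) = b / (a + b) := by field_simp; ring
    rw [e]
    linarith

lemma one_div_mul_sum_comp_eq_sum_card_div_mul {X : Type*} [DecidableEq X] {n : ℕ}
    (g : Fin n → X) (S : Finset X) (hS : ∀ i, g i ∈ S) (f : X → ℝ) :
    (1 / n : ℝ) * ∑ i, f (g i) =
      ∑ x ∈ S, ((Finset.univ.filter fun i => g i = x).card : ℝ) / n * f x := by
  rw [← Finset.sum_fiberwise_of_maps_to (s := Finset.univ) (fun i _ => hS i), Finset.mul_sum]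
  refine Finset.sum_congr rfl fun x _ => ?_
  rw [Finset.sum_congr rfl (g := fun _ => f x) fun i hi => by rw [(Finset.mem_filter.1 hi).2],
    Finset.sum_const, nsmul_eq_mul]
  ring

/-- For finitely many generated points `G(z_1), …, G(z_N)` and data points `x_1, …, x_M`
in a set `X`, with empirical weights `δ_G(x) = #{i : G(z_i) = x}/N` and
`δ_r(x) = #{j : x_j = x}/M`, the supremum over discriminators `D : X → (0,1)` of
`(1/M) Σ_j log D(x_j) + (1/N) Σ_i log (1 - D(G(z_i)))` equals
`Σ_{x ∈ S} [δ_r(x) log (δ_r(x)/(δ_r(x)+δ_G(x))) + δ_G(x) log (δ_G(x)/(δ_r(x)+δ_G(x)))]`,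
where `S` is the (finite) set of all sample points; moreover the bound is approached by
discriminators taking the value `δ_r(x)/(δ_r(x)+δ_G(x))` at every `x ∈ S` where this
ratio lies in `(0,1)`. -/
theorem stmt5 {X : Type*} [DecidableEq X] {N M : ℕ} (hN : 0 < N) (hM : 0 < M)
    (g : Fin N → X) (xs : Fin M → X) :
    let δG : X → ℝ := fun x => ((Finset.univ.filter fun i => g i = x).card : ℝ) / N
    let δr : X → ℝ := fun x => ((Finset.univ.filter fun j => xs j = x).card : ℝ) / M
    let S : Finset X := Finset.univ.image g ∪ Finset.univ.image xs
    let F : (X → ℝ) → ℝ := fun D =>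
      (1 / M : ℝ) * ∑ j, Real.log (D (xs j)) + (1 / N : ℝ) * ∑ i, Real.log (1 - D (g i))
    let R : ℝ := ∑ x ∈ S, (δr x * Real.log (δr x / (δr x + δG x))
        + δG x * Real.log (δG x / (δr x + δG x)))
    (⨆ D : {D : X → ℝ // ∀ x, D x ∈ Set.Ioo (0 : ℝ) 1}, F D.1) = R ∧
      ∀ ε > (0 : ℝ), ∃ D : X → ℝ, (∀ x, D x ∈ Set.Ioo (0 : ℝ) 1) ∧
        (∀ x ∈ S, δr x / (δr x + δG x) ∈ Set.Ioo (0 : ℝ) 1 →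
          D x = δr x / (δr x + δG x)) ∧
        R - ε < F D := by
  intro δG δr S F R
  have hG (x) : 0 ≤ δG x := by positivity
  have hr (x) : 0 ≤ δr x := by positivity
  have hpos : ∀ x ∈ S, 0 < δr x + δG x := by
    intro x hx
    rcases Finset.mem_union.1 hx with h | h <;> obtain ⟨i, -, hi⟩ := Finset.mem_image.1 h
    · refine add_pos_of_nonneg_of_pos (hr x) (div_pos ?_ (by exact_mod_cast hN))
      exact_mod_cast Finset.card_pos.2 ⟨i, by simpa using hi⟩
    · refine add_pos_of_pos_of_nonneg (div_pos ?_ (by exact_mod_cast hM)) (hG x)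
      exact_mod_cast Finset.card_pos.2 ⟨i, by simpa using hi⟩
  have hF (D : X → ℝ) :
      F D = ∑ x ∈ S, (δr x * Real.log (D x) + δG x * Real.log (1 - D x)) := by
    rw [Finset.sum_add_distrib]
    exact congrArg₂ (· + ·)
      (one_div_mul_sum_comp_eq_sum_card_div_mul xs S (fun j => by simp [S])
        fun x => Real.log (D x))
      (one_div_mul_sum_comp_eq_sum_card_div_mul g S (fun i => by simp [S])
        fun x => Real.log (1 - D x))
  have happrox : ∀ ε > (0 : ℝ), ∃ D : X → ℝ, (∀ x, D x ∈ Set.Ioo (0 : ℝ) 1) ∧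
      (∀ x ∈ S, δr x / (δr x + δG x) ∈ Set.Ioo (0 : ℝ) 1 →
        D x = δr x / (δr x + δG x)) ∧
      R - ε < F D := by
    intro ε hε
    have hη : 0 < ε / (S.card + 1) := by positivity
    have hpt (x : X) : ∃ t ∈ Set.Ioo (0 : ℝ) 1, x ∈ S →
        (δr x / (δr x + δG x) ∈ Set.Ioo (0 : ℝ) 1 → t = δr x / (δr x + δG x)) ∧
        δr x * Real.log (δr x / (δr x + δG x)) + δG x * Real.log (δG x / (δr x + δG x))
          - ε / (S.card + 1) < δr x * Real.log t + δG x * Real.log (1 - t) := by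
      by_cases hx : x ∈ S
      · obtain ⟨t, ht, h⟩ :=
          exists_mem_Ioo_mul_log_add_mul_log_gt (hr x) (hG x) (hpos x hx) hη
        exact ⟨t, ht, fun _ => h⟩
      · exact ⟨1 / 2, by norm_num, fun h => absurd h hx⟩
    choose D hD h using hpt
    refine ⟨D, hD, fun x hx => (h x hx).1, ?_⟩
    have hsum := Finset.sum_le_sum fun x hx => (h x hx).2.le
    rw [Finset.sum_sub_distrib, Finset.sum_const, nsmul_eq_mul, ← hF D] at hsum
    have e : ε / (S.card + 1) * (S.card + 1) = ε := by field_simp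
    change R - _ ≤ _ at hsum
    linarith
  refine ⟨?_, happrox⟩
  have : Nonempty {D : X → ℝ // ∀ x, D x ∈ Set.Ioo (0 : ℝ) 1} :=
    ⟨⟨fun _ => 1 / 2, fun _ => by norm_num⟩⟩
  refine ciSup_eq_of_forall_le_of_forall_lt_exists_gt (fun D => ?_) fun w hw => ?_
  · rw [hF]
    exact Finset.sum_le_sum fun x hx =>
      mul_log_add_mul_log_one_sub_le (hr x) (hG x) (hpos x hx) (D.2 x)
  · obtain ⟨D, hD, -, h⟩ := happrox (R - w) (sub_pos.2 hw)
    exact ⟨⟨D, hD⟩, by linarith⟩
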